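/- arXiv:1109.4313 — 3 statements merged into one kernel-verified Lean document; each statement's English description precedes it below -/
import Mathlib

section
/- Let X be a complex Banach space having Fourier type p for some p ∈ (1,2] with constant c_p, let β > 0 and ρ > 0, and let w ⊂ ℝ be a finite interval. Suppose f : w → X is strongly measurable with (1/|w|) ∫_w ‖f(x)‖_X (log⁺‖f(x)‖_X)^β dx ≤ ρ. Then there exist constants a(ρ,β) > 0 and A(ρ,β) > 0, depending only on ρ, β, p and c_p, such that Σ_{k∈ℤ} exp(−a(ρ,β) ‖f̂_w(k)‖_X^{−1/β}) ≤ A(ρ,β), with the convention that a summand is 0 when f̂_w(k) = 0. -/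
open MeasureTheory Filter Set Topology Real
open scoped ENNReal NNReal

noncomputable section

universe u
section
variable {X : Type*} [NormedAddCommGroup X] [NormedSpace ℂ X]

/-- Generalized Fourier coefficient on the interval `w = (a,b)`:
`f̂_w(α) = (1/|w|) ∫_w f(t) e^{-2πiαt/|w|} dt`. -/
def intervalFourierCoeff (f : ℝ → X) (a b : ℝ) (α : ℝ) : X :=
  (b - a)⁻¹ • ∫ t in Ioo a b,
    Complex.exp (-(2 * (π : ℂ) * Complex.I * (α : ℂ) * (t : ℂ)) / ((b : ℂ) - (a : ℂ))) • f t

/-- `X` has Fourier type `p` with constant `c`. -/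
def HasFourierTypeWith (X : Type*) [NormedAddCommGroup X] [NormedSpace ℂ X]
    (p c : ℝ) : Prop :=
  ∀ a b : ℝ, a < b → ∀ f : ℝ → X, AEStronglyMeasurable f (volume.restrict (Ioo a b)) →
    (∑' k : ℤ, (‖intervalFourierCoeff f a b k‖₊ : ℝ≥0∞) ^ (p / (p - 1))) ^ ((p - 1) / p)
      ≤ ENNReal.ofReal c *
        ((ENNReal.ofReal (b - a))⁻¹ * ∫⁻ t in Ioo a b, (‖f t‖₊ : ℝ≥0∞) ^ p) ^ (1 / p)

/-- `log⁺ u = max (log u) 0`. -/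
def logPlus (u : ℝ) : ℝ := max (Real.log u) 0

/-- The normalized `L (log L)^β` "norm" `(1/|w|) ∫_w ‖f‖ (log⁺‖f‖)^β` on `w = (a,b)`. -/
def avgLlogL (f : ℝ → X) (β a b : ℝ) : ℝ≥0∞ :=
  (ENNReal.ofReal (b - a))⁻¹ *
    ∫⁻ x in Ioo a b, ENNReal.ofReal (‖f x‖ * logPlus ‖f x‖ ^ β)

/-- Carleson average `C_k(f,w) = γ⁻¹ Σ_μ ‖f̂_w(k+μ/3)‖/(1+μ²)`. -/
def carlesonAvg (f : ℝ → X) (a b : ℝ) (k : ℤ) : ℝ :=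
  (∑' μ : ℤ, (1 + (μ : ℝ) ^ 2)⁻¹)⁻¹ *
    ∑' μ : ℤ, ‖intervalFourierCoeff f a b ((k : ℝ) + (μ : ℝ) / 3)‖ / (1 + (μ : ℝ) ^ 2)
end

/-- `exp(-a t^{-1/β})`, with the convention that it is `0` when `t = 0`. -/
def expWeight (a β t : ℝ) : ℝ :=
  if t = 0 then 0 else Real.exp (-a * t ^ (-(1 / β)))

section
variable {X : Type*} [NormedAddCommGroup X] [NormedSpace ℂ X]

lemma norm_fourierKernel (a b α t : ℝ) :
    ‖Complex.exp (-(2 * (π : ℂ) * Complex.I * (α : ℂ) * (t : ℂ)) / ((b : ℂ) - (a : ℂ)))‖ = 1 := by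
  rw [← Complex.norm_exp_ofReal_mul_I (-(2 * π * α * t) / (b - a))]
  congr 2
  push_cast
  ring

lemma aestronglyMeasurable_fourierKernel_smul {f : ℝ → X} {a b : ℝ} (α : ℝ)
    (hf : AEStronglyMeasurable f (volume.restrict (Ioo a b))) :
    AEStronglyMeasurable (fun t : ℝ ↦
      Complex.exp (-(2 * (π : ℂ) * Complex.I * (α : ℂ) * (t : ℂ)) / ((b : ℂ) - (a : ℂ))) • f t)
      (volume.restrict (Ioo a b)) := by
  refine AEStronglyMeasurable.smul (Continuous.aestronglyMeasurable ?_) hf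
  fun_prop

lemma integrable_fourierKernel_smul {f : ℝ → X} {a b : ℝ} (α : ℝ)
    (hf : IntegrableOn f (Ioo a b)) :
    IntegrableOn (fun t : ℝ ↦
      Complex.exp (-(2 * (π : ℂ) * Complex.I * (α : ℂ) * (t : ℂ)) / ((b : ℂ) - (a : ℂ))) • f t)
      (Ioo a b) := by
  refine Integrable.mono hf (aestronglyMeasurable_fourierKernel_smul α hf.1) ?_
  filter_upwards with t
  rw [norm_smul, norm_fourierKernel, one_mul]

lemma intervalFourierCoeff_add {f g : ℝ → X} {a b : ℝ} (α : ℝ)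
    (hf : IntegrableOn f (Ioo a b)) (hg : IntegrableOn g (Ioo a b)) :
    intervalFourierCoeff (f + g) a b α =
      intervalFourierCoeff f a b α + intervalFourierCoeff g a b α := by
  simp only [intervalFourierCoeff, Pi.add_apply, smul_add]
  rw [integral_add (integrable_fourierKernel_smul α hf) (integrable_fourierKernel_smul α hg),
    smul_add]

lemma enorm_intervalFourierCoeff_le (f : ℝ → X) {a b : ℝ} (hab : a < b) (α : ℝ) :
    ‖intervalFourierCoeff f a b α‖ₑ ≤
      (ENNReal.ofReal (b - a))⁻¹ * ∫⁻ t in Ioo a b, ‖f t‖ₑ := by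
  have hpos : 0 < b - a := sub_pos.2 hab
  rw [intervalFourierCoeff, enorm_smul, Real.enorm_of_nonneg (by positivity),
    ENNReal.ofReal_inv_of_pos hpos]
  gcongr
  refine (enorm_integral_le_lintegral_enorm _).trans (lintegral_mono fun t ↦ ?_)
  rw [enorm_smul, ← ofReal_norm, norm_fourierKernel, ENNReal.ofReal_one, one_mul]

/-- For a function bounded by `N`, the Fourier type inequality bounds the `ℓ^q` sum of the
coefficients. -/
lemma HasFourierTypeWith.tsum_rpow_le {p c : ℝ} (hX : HasFourierTypeWith X p c) (hp : 1 < p)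
    {a b : ℝ} (hab : a < b) {f : ℝ → X}
    (hf : AEStronglyMeasurable f (volume.restrict (Ioo a b))) {N : ℝ} (hN : 0 ≤ N)
    (hc : 0 ≤ c) (hfN : ∀ t, ‖f t‖ ≤ N) :
    ∑' k : ℤ, ‖intervalFourierCoeff f a b k‖ₑ ^ (p / (p - 1)) ≤
      ENNReal.ofReal ((c * N) ^ (p / (p - 1))) := by
  have hp0 : 0 < p := by linarith
  have hp1 : 0 < p - 1 := by linarith
  have hpos : 0 < b - a := sub_pos.2 hab
  have havg : (ENNReal.ofReal (b - a))⁻¹ * ∫⁻ t in Ioo a b, ‖f t‖ₑ ^ p ≤ ENNReal.ofReal N ^ p := by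
    calc (ENNReal.ofReal (b - a))⁻¹ * ∫⁻ t in Ioo a b, ‖f t‖ₑ ^ p
        ≤ (ENNReal.ofReal (b - a))⁻¹ * ∫⁻ _ in Ioo a b, ENNReal.ofReal N ^ p := by
          gcongr with t
          rw [← ofReal_norm]
          exact ENNReal.ofReal_le_ofReal (hfN t)
      _ = ENNReal.ofReal N ^ p := by
          rw [setLIntegral_const, Real.volume_Ioo, mul_comm, mul_assoc,
            ENNReal.mul_inv_cancel (by simpa using hpos) ENNReal.ofReal_ne_top, mul_one]
  have hroot : (∑' k : ℤ, ‖intervalFourierCoeff f a b k‖ₑ ^ (p / (p - 1))) ^ ((p - 1) / p) ≤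
      ENNReal.ofReal (c * N) := by
    refine (hX a b hab f hf).trans ?_
    rw [ENNReal.ofReal_mul hc]
    gcongr
    refine (ENNReal.rpow_le_rpow havg (by positivity)).trans_eq ?_
    rw [← ENNReal.rpow_mul, mul_one_div_cancel hp0.ne', ENNReal.rpow_one]
  have := ENNReal.rpow_le_rpow hroot (z := p / (p - 1)) (by positivity)
  rw [← ENNReal.rpow_mul, div_mul_div_cancel₀ hp0.ne', div_self hp1.ne', ENNReal.rpow_one] at this
  rwa [← ENNReal.ofReal_rpow_of_nonneg (by positivity) (by positivity)]

/-- The part of `f` where `‖f‖ > exp l` has small average when `f` lies in `L (log L)^β`. -/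
lemma avg_enorm_indicator_lt_le {X : Type*} [NormedAddCommGroup X]
    {f : ℝ → X} {a b β l ρ : ℝ} (hβ : 0 < β)
    (hl : 0 < l) (hf : avgLlogL f β a b ≤ ENNReal.ofReal ρ) :
    (ENNReal.ofReal (b - a))⁻¹ * ∫⁻ t in Ioo a b, ‖{t | ‖f t‖ ≤ Real.exp l}ᶜ.indicator f t‖ₑ ≤
      ENNReal.ofReal (ρ / l ^ β) := by
  have hlβ : 0 < l ^ β := Real.rpow_pos_of_pos hl β
  have hpt (t : ℝ) : ‖{t | ‖f t‖ ≤ Real.exp l}ᶜ.indicator f t‖ₑ ≤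
      ENNReal.ofReal (l ^ β)⁻¹ * ENNReal.ofReal (‖f t‖ * logPlus ‖f t‖ ^ β) := by
    by_cases ht : ‖f t‖ ≤ Real.exp l
    · simp [ht]
    · rw [indicator_of_mem (by simpa using ht), ← ofReal_norm,
        ← ENNReal.ofReal_mul (by positivity)]
      refine ENNReal.ofReal_le_ofReal ?_
      have hlog : l ≤ logPlus ‖f t‖ :=
        ((Real.le_log_iff_exp_le ((Real.exp_pos l).trans (not_le.1 ht))).2
          (not_le.1 ht).le).trans (le_max_left _ _)
      rw [inv_mul_eq_div, le_div_iff₀ hlβ]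
      gcongr
  calc (ENNReal.ofReal (b - a))⁻¹ * ∫⁻ t in Ioo a b, ‖{t | ‖f t‖ ≤ Real.exp l}ᶜ.indicator f t‖ₑ
      ≤ (ENNReal.ofReal (b - a))⁻¹ * ∫⁻ t in Ioo a b,
          ENNReal.ofReal (l ^ β)⁻¹ * ENNReal.ofReal (‖f t‖ * logPlus ‖f t‖ ^ β) := by
        gcongr with t
        exact hpt t
    _ = ENNReal.ofReal (l ^ β)⁻¹ * avgLlogL f β a b := by
        rw [lintegral_const_mul' _ _ ENNReal.ofReal_ne_top, avgLlogL, mul_left_comm]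
    _ ≤ ENNReal.ofReal (l ^ β)⁻¹ * ENNReal.ofReal ρ := by gcongr
    _ = ENNReal.ofReal (ρ / l ^ β) := by
        rw [← ENNReal.ofReal_mul (by positivity), inv_mul_eq_div]

/-- Truncating `f` at height `exp l` changes each Fourier coefficient by at most `ρ / l ^ β`. -/
lemma norm_intervalFourierCoeff_le_truncation {f : ℝ → X} {a b β l ρ : ℝ} (hab : a < b)
    (hβ : 0 < β) (hl : 0 < l) (hρ : 0 ≤ ρ)
    (hfm : AEStronglyMeasurable f (volume.restrict (Ioo a b)))
    (hf : avgLlogL f β a b ≤ ENNReal.ofReal ρ) (α : ℝ) :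
    ‖intervalFourierCoeff f a b α‖ ≤
      ‖intervalFourierCoeff ({t | ‖f t‖ ≤ Real.exp l}.indicator f) a b α‖ + ρ / l ^ β := by
  set s : Set ℝ := {t | ‖f t‖ ≤ Real.exp l}
  have hpos : 0 < b - a := sub_pos.2 hab
  have hs : NullMeasurableSet s (volume.restrict (Ioo a b)) :=
    nullMeasurableSet_le hfm.norm.aemeasurable aemeasurable_const
  have hsmall : IntegrableOn (s.indicator f) (Ioo a b) := by
    refine Integrable.of_bound (hfm.indicator₀ hs) (Real.exp l) ?_
    filter_upwards with t
    by_cases ht : t ∈ s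
    · rw [indicator_of_mem ht]
      exact ht
    · rw [indicator_of_notMem ht, norm_zero]
      positivity
  have havg := avg_enorm_indicator_lt_le hβ hl hf
  have hlarge : IntegrableOn (sᶜ.indicator f) (Ioo a b) := by
    refine ⟨hfm.indicator₀ hs.compl, ?_⟩
    refine ENNReal.lt_top_of_mul_ne_top_right (havg.trans_lt ENNReal.ofReal_lt_top).ne ?_
    simp
  have hcoeff : ‖intervalFourierCoeff (sᶜ.indicator f) a b α‖ ≤ ρ / l ^ β := by
    rw [← ENNReal.ofReal_le_ofReal_iff (by positivity), ofReal_norm]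
    exact (enorm_intervalFourierCoeff_le _ hab α).trans havg
  calc ‖intervalFourierCoeff f a b α‖
      = ‖intervalFourierCoeff (s.indicator f) a b α +
          intervalFourierCoeff (sᶜ.indicator f) a b α‖ := by
        rw [← intervalFourierCoeff_add α hsmall hlarge, indicator_self_add_compl]
    _ ≤ _ := (norm_add_le _ _).trans (by gcongr)

end

lemma summable_add_one_rpow_mul_exp_neg (r : ℝ) :
    Summable fun n : ℕ ↦ ((n : ℝ) + 1) ^ r * Real.exp (-n) := by
  have h := ((summable_nat_add_iff 1).2
    (Real.summable_pow_mul_exp_neg_nat_mul ⌈r⌉₊ one_pos)).mul_left (Real.exp 1)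
  refine h.of_nonneg_of_le (fun n ↦ by positivity) fun n ↦ ?_
  have hexp : Real.exp (-(n : ℝ)) = Real.exp 1 * Real.exp (-1 * ((n + 1 : ℕ) : ℝ)) := by
    rw [← Real.exp_add]
    congr 1
    push_cast
    ring
  rw [hexp, mul_left_comm, ← Real.rpow_natCast]
  gcongr
  · push_cast
    have hn : (0 : ℝ) ≤ n := n.cast_nonneg
    exact Real.rpow_le_rpow_of_exponent_le (by linarith) (Nat.le_ceil r)

/-- If `t ≤ u n + (n + 1)^(-β) / 2` for every `n`, then `exp (-a t^(-1/β))` is controlled by one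
of the terms `exp (-a n) (2 (n + 1)^β u n)^q`. -/
lemma exists_expWeight_le {a β q t : ℝ} (ha : 0 < a) (hβ : 0 < β) (hq : 0 < q) (ht : 0 < t)
    {u : ℕ → ℝ} (hu : ∀ n : ℕ, t ≤ u n + ((n : ℝ) + 1) ^ (-β) / 2) :
    ∃ n : ℕ, expWeight a β t ≤ Real.exp (-a * n) * (2 * ((n : ℝ) + 1) ^ β * u n) ^ q := by
  set v : ℝ := t ^ (-(1 / β)) with hv
  have hv0 : 0 < v := Real.rpow_pos_of_pos ht _
  refine ⟨⌊v⌋₊, ?_⟩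
  set n := ⌊v⌋₊
  have hn0 : (0 : ℝ) < n + 1 := by positivity
  have hvt : v ^ (-β) = t := by
    rw [hv, ← Real.rpow_mul ht.le, neg_mul_neg, one_div_mul_cancel hβ.ne', Real.rpow_one]
  have htn : ((n : ℝ) + 1) ^ (-β) ≤ t := by
    rw [← hvt]
    exact Real.rpow_le_rpow_of_nonpos hv0 (Nat.lt_floor_add_one v).le (by linarith)
  have hone : 1 ≤ 2 * ((n : ℝ) + 1) ^ β * u n := by
    have h1 : ((n : ℝ) + 1) ^ (-β) ≤ 2 * u n := by linarith [hu n]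
    rw [Real.rpow_neg hn0.le, inv_le_iff_one_le_mul₀ (by positivity)] at h1
    linarith
  rw [expWeight, if_neg ht.ne']
  refine le_trans ?_ (le_mul_of_one_le_right (Real.exp_pos _).le (Real.one_le_rpow hone hq.le))
  refine Real.exp_le_exp.2 ?_
  have := Nat.floor_le hv0.le
  nlinarith

/-- Theorem B: if `X` has Fourier type `p ∈ (1,2]` with constant `c_p`, `β, ρ > 0`
and `(1/|w|) ∫_w ‖f‖ (log⁺‖f‖)^β ≤ ρ` on a finite interval `w`, then
`Σ_k exp(-a ‖f̂_w(k)‖^{-1/β}) ≤ A` for constants `a, A > 0` depending only on `ρ, β, p, c_p`. -/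
theorem statement1 (p cp β ρ : ℝ) (hp1 : 1 < p) (hp2 : p ≤ 2) (hcp : 0 < cp)
    (hβ : 0 < β) (hρ : 0 < ρ) :
    ∃ a A : ℝ, 0 < a ∧ 0 < A ∧
      ∀ (X : Type u) [NormedAddCommGroup X] [NormedSpace ℂ X] [CompleteSpace X],
        HasFourierTypeWith X p cp →
        ∀ w₁ w₂ : ℝ, w₁ < w₂ → ∀ f : ℝ → X,
          AEStronglyMeasurable f (volume.restrict (Ioo w₁ w₂)) →
          avgLlogL f β w₁ w₂ ≤ ENNReal.ofReal ρ →
          (∑' k : ℤ, ENNReal.ofReal (expWeight a β ‖intervalFourierCoeff f w₁ w₂ k‖)) ≤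
            ENNReal.ofReal A := by
  set q : ℝ := p / (p - 1) with hq
  have hq0 : 0 < q := div_pos (by linarith) (by linarith)
  set L : ℝ := (2 * ρ) ^ (1 / β) with hL
  have hL0 : 0 < L := by positivity
  set a : ℝ := L * q + 1 with ha
  have ha0 : 0 < a := by positivity
  set B : ℕ → ℝ := fun n ↦ Real.exp (-a * n) *
    ((2 * ((n : ℝ) + 1) ^ β) ^ q * (cp * Real.exp (L * (n + 1))) ^ q) with hB
  have hB0 (n : ℕ) : 0 < B n := by positivity
  have hBsum : Summable B := by
    refine ((summable_add_one_rpow_mul_exp_neg (β * q)).mul_left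
      (2 ^ q * cp ^ q * Real.exp (L * q))).congr fun n ↦ ?_
    have hn : (0 : ℝ) ≤ n + 1 := by positivity
    rw [hB]
    dsimp only
    rw [Real.mul_rpow (by norm_num) (by positivity), Real.mul_rpow hcp.le (by positivity),
      ← Real.rpow_mul hn, ← Real.exp_mul]
    have hexp : Real.exp (L * q) * Real.exp (-n) =
        Real.exp (-a * n) * Real.exp (L * (n + 1) * q) := by
      rw [← Real.exp_add, ← Real.exp_add]
      congr 1
      rw [ha]
      ring
    linear_combination 2 ^ q * cp ^ q * ((n : ℝ) + 1) ^ (β * q) * hexp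
  refine ⟨a, ∑' n, B n, ha0, hBsum.tsum_pos (fun n ↦ (hB0 n).le) 0 (hB0 0), ?_⟩
  intro X _ _ _ hX w₁ w₂ hw f hfm hf
  set g : ℕ → ℝ → X := fun n ↦ {t | ‖f t‖ ≤ Real.exp (L * (n + 1))}.indicator f with hg
  have hgm (n : ℕ) : AEStronglyMeasurable (g n) (volume.restrict (Ioo w₁ w₂)) :=
    hfm.indicator₀ (nullMeasurableSet_le hfm.norm.aemeasurable aemeasurable_const)
  have hgN (n : ℕ) (t : ℝ) : ‖g n t‖ ≤ Real.exp (L * (n + 1)) := by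
    by_cases ht : ‖f t‖ ≤ Real.exp (L * (n + 1))
    · simp [hg, ht]
    · simp [hg, ht, Real.exp_nonneg]
  have hLβ : L ^ β = 2 * ρ := by
    rw [hL, ← Real.rpow_mul (by positivity), one_div_mul_cancel hβ.ne', Real.rpow_one]
  have hterm (k : ℤ) : ENNReal.ofReal (expWeight a β ‖intervalFourierCoeff f w₁ w₂ k‖) ≤
      ∑' n : ℕ, ENNReal.ofReal (Real.exp (-a * n) * (2 * ((n : ℝ) + 1) ^ β) ^ q) *
        ‖intervalFourierCoeff (g n) w₁ w₂ k‖ₑ ^ q := by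
    rcases (norm_nonneg (intervalFourierCoeff f w₁ w₂ k)).eq_or_lt with h0 | h0
    · simp [← h0, expWeight]
    obtain ⟨n, hn⟩ := exists_expWeight_le ha0 hβ hq0 h0
      (u := fun n ↦ ‖intervalFourierCoeff (g n) w₁ w₂ k‖) fun n ↦ by
        have hn : (0 : ℝ) < n + 1 := by positivity
        convert norm_intervalFourierCoeff_le_truncation hw hβ (mul_pos hL0 hn) hρ.le hfm hf k
          using 2
        rw [Real.mul_rpow hL0.le hn.le, hLβ, Real.rpow_neg hn.le]
        field_simp
    refine le_trans ?_ (ENNReal.le_tsum n)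
    rw [← ofReal_norm, ENNReal.ofReal_rpow_of_nonneg (norm_nonneg _) hq0.le,
      ← ENNReal.ofReal_mul (by positivity), mul_assoc,
      ← Real.mul_rpow (by positivity) (norm_nonneg _)]
    exact ENNReal.ofReal_le_ofReal hn
  calc ∑' k : ℤ, ENNReal.ofReal (expWeight a β ‖intervalFourierCoeff f w₁ w₂ k‖)
      ≤ ∑' k : ℤ, ∑' n : ℕ,
          ENNReal.ofReal (Real.exp (-a * n) * (2 * ((n : ℝ) + 1) ^ β) ^ q) *
            ‖intervalFourierCoeff (g n) w₁ w₂ k‖ₑ ^ q := ENNReal.tsum_le_tsum hterm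
    _ = ∑' n : ℕ, ENNReal.ofReal (Real.exp (-a * n) * (2 * ((n : ℝ) + 1) ^ β) ^ q) *
          ∑' k : ℤ, ‖intervalFourierCoeff (g n) w₁ w₂ k‖ₑ ^ q := by
        rw [ENNReal.tsum_comm]
        simp_rw [ENNReal.tsum_mul_left]
    _ ≤ ∑' n : ℕ, ENNReal.ofReal (B n) := by
        refine ENNReal.tsum_le_tsum fun n ↦ ?_
        rw [hB]
        dsimp only
        rw [← mul_assoc, ENNReal.ofReal_mul
          (p := Real.exp (-a * n) * (2 * ((n : ℝ) + 1) ^ β) ^ q) (by positivity)]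
        gcongr
        exact hX.tsum_rpow_le hp1 hw (hgm n) (Real.exp_pos _).le hcp.le (hgN n)
    _ = ENNReal.ofReal (∑' n, B n) :=
        (ENNReal.ofReal_tsum_of_nonneg (fun n ↦ (hB0 n).le) hBsum).symm

end
end

section
/- Let X be any Banach space, α > 1, w ⊂ ℝ a finite interval, and σ : ℤ → ℤ a permutation. Then there is a constant c_α, depending only on α, such that for every f ∈ L_1(w, dt/|w|; X) and every λ > 0, Σ_{k ∈ ℤ∖{0}, |k|^{α−1}‖f̂_w(σ(k))‖_X > λ} |k|^{−α} ≤ (c_α/λ) (1/|w|)∫_w ‖f(t)‖_X dt. In other words, the map Λ_σ f = (|k|^{α−1} f̂_w(σ(k)))_{k∈ℤ} is bounded from L_1(w, dt/|w|; X) to weak-L_1(ℤ, ν_α; X). -/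
open MeasureTheory Filter Set Topology Real
open scoped ENNReal NNReal

noncomputable section

universe u
theorem norm_intervalFourierCoeff_le {X : Type*} [NormedAddCommGroup X] [NormedSpace ℂ X]
    (f : ℝ → X) {a b : ℝ} (hab : a < b) (ξ : ℝ) :
    ‖intervalFourierCoeff f a b ξ‖ ≤ (b - a)⁻¹ * ∫ t in Ioo a b, ‖f t‖ := by
  have hba : 0 ≤ (b - a)⁻¹ := inv_nonneg.2 (sub_nonneg.2 hab.le)
  rw [intervalFourierCoeff, norm_smul, Real.norm_of_nonneg hba]
  refine mul_le_mul_of_nonneg_left ?_ hba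
  refine (norm_integral_le_integral_norm _).trans_eq (integral_congr_ae (.of_forall fun t ↦ ?_))
  have harg : -(2 * (π : ℂ) * Complex.I * (ξ : ℂ) * (t : ℂ)) / ((b : ℂ) - (a : ℂ)) =
      ((-(2 * π * ξ * t) / (b - a) : ℝ) : ℂ) * Complex.I := by
    push_cast
    ring
  simp only [harg, norm_smul, Complex.norm_exp_ofReal_mul_I, one_mul]

theorem rpow_neg_add_one_le_mul_sub {β x : ℝ} (hβ : 0 < β) (hx : 1 ≤ x) :
    x ^ (-(β + 1)) ≤ 2 ^ (β + 1) / β * (x ^ (-β) - (x + 1) ^ (-β)) := by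
  have hx0 : 0 < x := by linarith
  have hx1 : 0 < x + 1 := by linarith
  have hratio : 1 + β / (x + 1) ≤ ((x + 1) / x) ^ β := by
    have hlog := Real.one_sub_inv_le_log_of_pos (div_pos hx1 hx0)
    rw [inv_div] at hlog
    have h1 : 1 - x / (x + 1) = 1 / (x + 1) := by field_simp; ring
    rw [Real.rpow_def_of_pos (div_pos hx1 hx0)]
    calc 1 + β / (x + 1) = β * (1 - x / (x + 1)) + 1 := by rw [h1]; ring
      _ ≤ Real.log ((x + 1) / x) * β + 1 := by nlinarith
      _ ≤ _ := Real.add_one_le_exp _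
  have hsub : β * (x + 1) ^ (-(β + 1)) ≤ x ^ (-β) - (x + 1) ^ (-β) := by
    have h := mul_le_mul_of_nonneg_left hratio (Real.rpow_nonneg hx1.le (-β))
    have hl : (x + 1) ^ (-(β + 1)) = (x + 1) ^ (-β) / (x + 1) := by
      rw [neg_add, ← sub_eq_add_neg, Real.rpow_sub_one hx1.ne']
    have hr : (x + 1) ^ (-β) * ((x + 1) / x) ^ β = x ^ (-β) := by
      rw [Real.div_rpow hx1.le hx0.le, Real.rpow_neg hx1.le, Real.rpow_neg hx0.le]
      have := (Real.rpow_pos_of_pos hx1 β).ne'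
      field_simp
    rw [hr] at h
    rw [hl]
    linarith [show (x + 1) ^ (-β) * (1 + β / (x + 1)) =
      (x + 1) ^ (-β) + β * ((x + 1) ^ (-β) / (x + 1)) by ring]
  have hdouble : x ^ (-(β + 1)) ≤ 2 ^ (β + 1) * (x + 1) ^ (-(β + 1)) := by
    calc x ^ (-(β + 1)) = 2 ^ (β + 1) * (2 * x) ^ (-(β + 1)) := by
          rw [Real.mul_rpow zero_le_two hx0.le, ← mul_assoc, ← Real.rpow_add two_pos]
          simp
      _ ≤ _ := mul_le_mul_of_nonneg_left
          (Real.rpow_le_rpow_of_nonpos hx1 (by linarith) (by linarith)) (by positivity)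
  calc x ^ (-(β + 1)) ≤ 2 ^ (β + 1) * (x + 1) ^ (-(β + 1)) := hdouble
    _ = 2 ^ (β + 1) / β * (β * (x + 1) ^ (-(β + 1))) := by field_simp
    _ ≤ _ := mul_le_mul_of_nonneg_left hsub (by positivity)

open Classical in
theorem tsum_rpow_neg_add_one_tail_le {β u : ℝ} (hβ : 0 < β) (hu : 0 ≤ u) :
    (∑' n : ℕ, if ((n : ℝ) + 1) ^ (-β) < u
      then ENNReal.ofReal (((n : ℝ) + 1) ^ (-(β + 1))) else 0) ≤
      ENNReal.ofReal (2 ^ (β + 1) / β * u) := by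
  have hC : (0 : ℝ) ≤ 2 ^ (β + 1) / β := by positivity
  set g : ℕ → ℝ := fun n ↦ min (((n : ℝ) + 1) ^ (-β)) u with hg
  have hanti (n : ℕ) : ((n : ℝ) + 1 + 1) ^ (-β) ≤ ((n : ℝ) + 1) ^ (-β) :=
    Real.rpow_le_rpow_of_nonpos (by positivity) (by linarith) (by linarith)
  have hterm (n : ℕ) : (if ((n : ℝ) + 1) ^ (-β) < u
      then ENNReal.ofReal (((n : ℝ) + 1) ^ (-(β + 1))) else 0) ≤
      ENNReal.ofReal (2 ^ (β + 1) / β * (g n - g (n + 1))) := by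
    split_ifs with h
    · refine ENNReal.ofReal_le_ofReal ?_
      simp only [hg, Nat.cast_add, Nat.cast_one, min_eq_left h.le,
        min_eq_left ((hanti n).trans h.le)]
      exact rpow_neg_add_one_le_mul_sub hβ (by simp)
    · exact zero_le
  have hg_anti (n : ℕ) : g (n + 1) ≤ g n := by
    simpa only [hg, Nat.cast_add, Nat.cast_one] using min_le_min_right u (hanti n)
  refine ENNReal.tsum_le_of_sum_range_le fun N ↦ ?_
  calc _ ≤ ∑ n ∈ Finset.range N, ENNReal.ofReal (2 ^ (β + 1) / β * (g n - g (n + 1))) :=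
        Finset.sum_le_sum fun n _ ↦ hterm n
    _ = ENNReal.ofReal (2 ^ (β + 1) / β * (g 0 - g N)) := by
        rw [← ENNReal.ofReal_sum_of_nonneg
          fun n _ ↦ mul_nonneg hC (sub_nonneg.2 (hg_anti n)), ← Finset.mul_sum,
          Finset.sum_range_sub']
    _ ≤ _ := by
        refine ENNReal.ofReal_le_ofReal (mul_le_mul_of_nonneg_left ?_ hC)
        have h0 : g 0 ≤ u := min_le_right _ _
        have hN : 0 ≤ g N := le_min (by positivity) hu
        linarith

open Classical in
/-- Lemma 2.1 i: for any (complex) Banach space `X`, `α > 1`, a finite interval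
`w`, and a permutation `σ` of `ℤ`, the map `Λ_σ f = (|k|^{α-1} f̂_w(σ(k)))_k` is bounded from
`L₁(w, dt/|w|; X)` to weak-`L₁(ℤ, ν_α; X)`, with constant depending only on `α`. -/
theorem statement7 (α : ℝ) (hα : 1 < α) :
    ∃ c : ℝ, 0 < c ∧
      ∀ (X : Type u) [NormedAddCommGroup X] [NormedSpace ℂ X] [CompleteSpace X]
        (w₁ w₂ : ℝ), w₁ < w₂ → ∀ σ : ℤ → ℤ, Function.Bijective σ →
        ∀ f : ℝ → X, IntegrableOn f (Ioo w₁ w₂) volume →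
        ∀ lam : ℝ, 0 < lam →
          (∑' k : ℤ,
              if k ≠ 0 ∧ lam < |(k : ℝ)| ^ (α - 1) * ‖intervalFourierCoeff f w₁ w₂ (σ k)‖
              then ENNReal.ofReal (|(k : ℝ)| ^ (-α)) else 0) ≤
            ENNReal.ofReal (c / lam * ((w₂ - w₁)⁻¹ * ∫ t in Ioo w₁ w₂, ‖f t‖)) := by
  obtain ⟨β, rfl⟩ : ∃ β, α = β + 1 := ⟨α - 1, by ring⟩
  have hβ : 0 < β := by linarith
  refine ⟨2 * (2 ^ (β + 1) / β), by positivity, ?_⟩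
  intro X _ _ _ w₁ w₂ hw σ _ f _ lam hlam
  set A := (w₂ - w₁)⁻¹ * ∫ t in Ioo w₁ w₂, ‖f t‖
  have hA0 : 0 ≤ A := mul_nonneg (inv_nonneg.2 (sub_nonneg.2 hw.le))
    (integral_nonneg fun t ↦ norm_nonneg _)
  have hterm (k : ℤ) (n : ℕ) (hk : |(k : ℝ)| = n + 1) :
      (if k ≠ 0 ∧ lam < |(k : ℝ)| ^ (β + 1 - 1) * ‖intervalFourierCoeff f w₁ w₂ (σ k)‖
        then ENNReal.ofReal (|(k : ℝ)| ^ (-(β + 1))) else 0) ≤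
      if ((n : ℝ) + 1) ^ (-β) < A / lam
        then ENNReal.ofReal (((n : ℝ) + 1) ^ (-(β + 1))) else 0 := by
    rw [hk, add_sub_cancel_right]
    split_ifs with h₁ h₂
    · exact le_rfl
    · refine absurd ?_ h₂
      have hpos : 0 < ((n : ℝ) + 1) ^ β := by positivity
      rw [Real.rpow_neg (by positivity), lt_div_iff₀ hlam, inv_mul_lt_iff₀ hpos]
      exact h₁.2.trans_le (mul_le_mul_of_nonneg_left
        (norm_intervalFourierCoeff_le f hw _) hpos.le)
    · exact zero_le
    · exact le_rfl
  have htail := tsum_rpow_neg_add_one_tail_le hβ (div_nonneg hA0 hlam.le)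
  rw [(HasSum.of_add_one_of_neg_add_one ENNReal.summable.hasSum
    ENNReal.summable.hasSum).tsum_eq]
  simp only [ne_eq, not_true_eq_false, false_and, if_false, add_zero]
  calc _ ≤ ENNReal.ofReal (2 ^ (β + 1) / β * (A / lam)) +
        ENNReal.ofReal (2 ^ (β + 1) / β * (A / lam)) := by
        refine add_le_add ((ENNReal.tsum_le_tsum fun n ↦ hterm _ n ?_).trans htail)
          ((ENNReal.tsum_le_tsum fun n ↦ hterm _ n ?_).trans htail)
        · push_cast
          exact abs_of_nonneg (by positivity)
        · push_cast
          rw [abs_neg]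
          exact abs_of_nonneg (by positivity)
    _ = _ := by
        rw [← ENNReal.ofReal_add (by positivity) (by positivity)]
        congr 1
        ring

end
end

section
/- There exist absolute constants c > 0 and c₀ > 0 such that the following holds. Let w* ⊂ ℝ be a finite interval and let Ω be a countable partition of w* into pairwise disjoint subintervals w'. Define Δ_Ω(x) = Σ_{w' ∈ Ω} |w'|² / ( (x − c(w'))² + |w'|² ), where c(w') is the center of w'. Then for every ρ > 0, |{ x ∈ w* : Δ_Ω(x) > ρ }| ≤ c · exp(−c₀ ρ) · |w*|. -/
open MeasureTheory Filter Set Topology Real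
open scoped ENNReal NNReal

noncomputable section

universe u
/-- The Cauchy bump `|w|² / ((x - c(w))² + |w|²)` attached to the interval `w = (p, q)`. -/
def bump (p q x : ℝ) : ℝ := (q - p) ^ 2 / ((x - (p + q) / 2) ^ 2 + (q - p) ^ 2)

/-- The product of `1 + bump / 400` over a finite family of intervals. -/
def bumpProd {ι : Type*} (a b : ι → ℝ) (S : Finset ι) (x : ℝ) : ℝ :=
  ∏ i ∈ S, (1 + 1 / 400 * bump (a i) (b i) x)

lemma bump_nonneg (p q x : ℝ) : 0 ≤ bump p q x := by
  unfold bump; positivity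

lemma bump_le_one (p q x : ℝ) : bump p q x ≤ 1 := by
  unfold bump
  exact div_le_one_of_le₀ (by nlinarith [sq_nonneg (x - (p + q) / 2)]) (by positivity)

lemma continuous_bump {p q : ℝ} (h : p < q) : Continuous (bump p q) := by
  unfold bump
  refine Continuous.div (by fun_prop) (by fun_prop) fun x => ?_
  have : 0 < q - p := sub_pos.2 h
  positivity

lemma bump_eq {p q : ℝ} (h : p < q) :
    bump p q = fun x => (1 + ((x - (p + q) / 2) / (q - p)) ^ 2)⁻¹ := by
  have : 0 < q - p := sub_pos.2 h
  funext x
  unfold bump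
  have h1 : (x - (p + q) / 2) ^ 2 + (q - p) ^ 2 ≠ 0 := by positivity
  have h2 : 1 + ((x - (p + q) / 2) / (q - p)) ^ 2 ≠ 0 := by positivity
  rw [eq_comm, inv_eq_iff_eq_inv, inv_div]
  field_simp
  ring

lemma integrable_bump {p q : ℝ} (h : p < q) : Integrable (bump p q) := by
  rw [bump_eq h]
  exact (integrable_inv_one_add_sq.comp_div (sub_pos.2 h).ne').comp_sub_right ((p + q) / 2)

lemma integral_bump {p q : ℝ} (h : p < q) : ∫ x, bump p q x = π * (q - p) := by
  rw [bump_eq h, integral_sub_right_eq_self (fun x => (1 + (x / (q - p)) ^ 2)⁻¹) ((p + q) / 2),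
    Measure.integral_comp_div (fun x => (1 + x ^ 2)⁻¹) (q - p), integral_univ_inv_one_add_sq,
    abs_of_pos (sub_pos.2 h), smul_eq_mul, mul_comm]

/-- Away from the midpoint of the two centers, one bump is comparable to its value at the center
of the other. -/
lemma bump_le_four_mul {p q x y : ℝ} (h : p < q)
    (hx : (y - (p + q) / 2) ^ 2 ≤ 4 * (x - (p + q) / 2) ^ 2) :
    bump p q x ≤ 4 * bump p q y := by
  have : 0 < q - p := sub_pos.2 h
  unfold bump
  rw [← mul_div_assoc, div_le_div_iff₀ (by positivity) (by positivity)]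
  nlinarith [mul_le_mul_of_nonneg_left hx (sq_nonneg (q - p)), sq_nonneg ((q - p) ^ 2)]

lemma bump_mul_bump_le {p q r s : ℝ} (h : p < q) (h' : r < s) (x : ℝ) :
    bump p q x * bump r s x ≤
      4 * (bump p q ((r + s) / 2) * bump r s x + bump r s ((p + q) / 2) * bump p q x) := by
  have n1 := bump_nonneg p q x
  have n2 := bump_nonneg r s x
  have n3 := bump_nonneg p q ((r + s) / 2)
  have n4 := bump_nonneg r s ((p + q) / 2)
  by_cases hx : ((r + s) / 2 - (p + q) / 2) ^ 2 ≤ 4 * (x - (p + q) / 2) ^ 2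
  · nlinarith [mul_le_mul_of_nonneg_right (bump_le_four_mul h hx) n2, mul_nonneg n4 n1]
  · have hx' : ((p + q) / 2 - (r + s) / 2) ^ 2 ≤ 4 * (x - (r + s) / 2) ^ 2 := by
      push Not at hx
      linarith [sq_nonneg ((x - (p + q) / 2) + (x - (r + s) / 2))]
    nlinarith [mul_le_mul_of_nonneg_right (bump_le_four_mul h' hx') n1, mul_nonneg n3 n2]

/-- The interaction of the interval `(p, q)` with a smaller disjoint interval `(r, s)` is
controlled by the mass that the bump of `(p, q)` gives to `(r, s)`. -/
lemma bump_interaction_le {p q r s : ℝ} (h : p < q) (h' : r < s) (hle : s - r ≤ q - p)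
    (hd : Disjoint (Ioo p q) (Ioo r s)) :
    bump p q ((r + s) / 2) * (s - r) + bump r s ((p + q) / 2) * (q - p) ≤
      12 * ∫ x in Ioo r s, bump p q x := by
  have hH : 0 < q - p := sub_pos.2 h
  have hk : 0 < s - r := sub_pos.2 h'
  have key : q ≤ r ∨ s ≤ p := by
    rw [Ioo_disjoint_Ioo, min_le_iff, le_max_iff, le_max_iff] at hd
    rcases hd with (h1 | h1) | (h1 | h1)
    · linarith
    · exact .inl h1
    · exact .inr h1
    · linarith
  have hD : ((q - p) / 2) ^ 2 ≤ ((r + s) / 2 - (p + q) / 2) ^ 2 := by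
    rcases key with h1 | h1
    · exact pow_le_pow_left₀ (by linarith) (by linarith) 2
    · rw [← neg_sq ((r + s) / 2 - (p + q) / 2)]
      exact pow_le_pow_left₀ (by linarith) (by linarith) 2
  have h1 : bump r s ((p + q) / 2) * (q - p) ≤ 5 * (bump p q ((r + s) / 2) * (s - r)) := by
    unfold bump
    rw [div_mul_eq_mul_div, div_mul_eq_mul_div, ← mul_div_assoc,
      div_le_div_iff₀ (by positivity) (by positivity)]
    have e : ((p + q) / 2 - (r + s) / 2) ^ 2 = ((r + s) / 2 - (p + q) / 2) ^ 2 := by ring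
    rw [e]
    set d := ((r + s) / 2 - (p + q) / 2) ^ 2
    set H := q - p
    set k := s - r
    have h2 : k * (d + H ^ 2) ≤ 5 * H * (d + k ^ 2) :=
      calc k * (d + H ^ 2) ≤ H * (d + H ^ 2) := by gcongr
        _ ≤ H * (5 * d) := by gcongr; linarith
        _ ≤ 5 * H * (d + k ^ 2) := by nlinarith [mul_pos hH (pow_pos hk 2)]
    nlinarith [mul_le_mul_of_nonneg_left h2 (mul_pos hk hH).le]
  have h2 : bump p q ((r + s) / 2) * (s - r) ≤ 2 * ∫ x in Ioo r s, bump p q x := by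
    have h3 : ∀ x ∈ Ioo r s, bump p q ((r + s) / 2) / 2 ≤ bump p q x := by
      intro x hx
      have h4 : (x - (p + q) / 2) ^ 2 ≤
          2 * ((r + s) / 2 - (p + q) / 2) ^ 2 + 2 * ((q - p) / 2) ^ 2 := by
        have h5 : (x - (r + s) / 2) ^ 2 ≤ ((q - p) / 2) ^ 2 :=
          sq_le_sq' (by linarith [hx.1]) (by linarith [hx.2])
        nlinarith [sq_nonneg ((x - (r + s) / 2) - ((r + s) / 2 - (p + q) / 2))]
      unfold bump
      rw [div_div]
      exact div_le_div_of_nonneg_left (by positivity) (by positivity) (by nlinarith)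
    have h4 := setIntegral_ge_of_const_le_real (μ := volume) measurableSet_Ioo (by simp) h3
      (integrable_bump h).integrableOn
    rw [Real.volume_real_Ioo_of_le h'.le] at h4
    linarith
  linarith

section Family

variable {ι : Type*} {a b : ι → ℝ}

lemma sum_setIntegral_Ioo_le {f : ℝ → ℝ} (hf : Integrable f) (hf0 : ∀ x, 0 ≤ f x)
    (hd : ∀ i j, i ≠ j → Disjoint (Ioo (a i) (b i)) (Ioo (a j) (b j))) (S : Finset ι) :
    ∑ i ∈ S, ∫ x in Ioo (a i) (b i), f x ≤ ∫ x, f x := by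
  rw [← integral_biUnion_finset S (fun i _ => measurableSet_Ioo) (fun i _ j _ hij => hd i j hij)
    fun i _ => hf.integrableOn]
  exact setIntegral_le_integral hf (Eventually.of_forall hf0)

lemma sum_length_le {A B : ℝ} (hAB : A < B) (hab : ∀ i, a i < b i)
    (hsub : ∀ i, Ioo (a i) (b i) ⊆ Ioo A B)
    (hd : ∀ i j, i ≠ j → Disjoint (Ioo (a i) (b i)) (Ioo (a j) (b j))) (S : Finset ι) :
    ∑ i ∈ S, (b i - a i) ≤ B - A := by
  have h := sum_setIntegral_Ioo_le (f := (Ioo A B).indicator fun _ => (1 : ℝ))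
    ((integrable_indicator_iff measurableSet_Ioo).2 (integrableOn_const (by simp)))
    (fun x => indicator_nonneg (fun _ _ => zero_le_one) x) hd S
  rw [integral_indicator measurableSet_Ioo, setIntegral_const,
    Real.volume_real_Ioo_of_le hAB.le, smul_eq_mul, mul_one] at h
  refine le_trans (Finset.sum_le_sum fun i _ => ?_) h
  rw [setIntegral_indicator measurableSet_Ioo, inter_eq_left.2 (hsub i), setIntegral_const,
    Real.volume_real_Ioo_of_le (hab i).le, smul_eq_mul, mul_one]

lemma bumpProd_nonneg (S : Finset ι) (x : ℝ) : 0 ≤ bumpProd a b S x :=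
  Finset.prod_nonneg fun i _ => by have := bump_nonneg (a i) (b i) x; positivity

lemma continuous_bumpProd (hab : ∀ i, a i < b i) (S : Finset ι) :
    Continuous (bumpProd a b S) :=
  continuous_finsetProd S fun i _ =>
    continuous_const.add (continuous_const.mul (continuous_bump (hab i)))

lemma bumpProd_le (S : Finset ι) (x : ℝ) : bumpProd a b S x ≤ 2 ^ S.card := by
  rw [← Finset.prod_const]
  refine Finset.prod_le_prod (fun i _ => ?_) fun i _ => ?_
  · have := bump_nonneg (a i) (b i) x
    positivity
  · linarith [bump_le_one (a i) (b i) x]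

lemma exp_sum_le_bumpProd (S : Finset ι) (x : ℝ) :
    rexp (1 / 800 * ∑ i ∈ S, bump (a i) (b i) x) ≤ bumpProd a b S x := by
  rw [Finset.mul_sum, Real.exp_sum]
  refine Finset.prod_le_prod (fun i _ => (Real.exp_pos _).le) fun i _ => ?_
  have h0 := bump_nonneg (a i) (b i) x
  have h1 := bump_le_one (a i) (b i) x
  set t := bump (a i) (b i) x
  have h2 := Real.add_one_le_exp (-(1 / 800 * t))
  have h3 : rexp (1 / 800 * t) * rexp (-(1 / 800 * t)) = 1 := by
    rw [← Real.exp_add, add_neg_cancel, Real.exp_zero]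
  have h4 := Real.exp_pos (1 / 800 * t)
  have h5 : rexp (1 / 800 * t) * (-(1 / 800 * t) + 1) ≤ 1 :=
    (mul_le_mul_of_nonneg_left h2 h4.le).trans_eq h3
  have h6 : 1 ≤ (1 + 1 / 400 * t) * (-(1 / 800 * t) + 1) := by nlinarith
  exact le_of_mul_le_mul_right (h5.trans h6) (by linarith)

lemma integrable_mul_bumpProd (hab : ∀ i, a i < b i) (S : Finset ι) {f : ℝ → ℝ}
    {μ : Measure ℝ} (hf : Integrable f μ) : Integrable (fun x => f x * bumpProd a b S x) μ :=
  hf.mul_bdd (c := 2 ^ S.card) (continuous_bumpProd hab S).aestronglyMeasurable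
    (Eventually.of_forall fun x => by
      rw [Real.norm_of_nonneg (bumpProd_nonneg S x)]; exact bumpProd_le S x)

lemma bumpProd_insert [DecidableEq ι] {S : Finset ι} {m : ι} (hm : m ∉ S) (x : ℝ) :
    bumpProd a b (insert m S) x =
      bumpProd a b S x + 1 / 400 * (bump (a m) (b m) x * bumpProd a b S x) := by
  rw [bumpProd, Finset.prod_insert hm, ← bumpProd]
  ring

lemma sum_interaction_le (hab : ∀ i, a i < b i)
    (hd : ∀ i j, i ≠ j → Disjoint (Ioo (a i) (b i)) (Ioo (a j) (b j))) {S : Finset ι}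
    {p q : ℝ} (h : p < q) (hle : ∀ i ∈ S, b i - a i ≤ q - p)
    (hpq : ∀ i ∈ S, Disjoint (Ioo p q) (Ioo (a i) (b i))) :
    ∑ i ∈ S, (bump p q ((a i + b i) / 2) * (b i - a i) +
      bump (a i) (b i) ((p + q) / 2) * (q - p)) ≤ 12 * (π * (q - p)) := by
  rw [← integral_bump h]
  refine (Finset.sum_le_sum fun i hi =>
    bump_interaction_le h (hab i) (hle i hi) (hpq i hi)).trans ?_
  rw [← Finset.mul_sum]
  gcongr
  exact sum_setIntegral_Ioo_le (integrable_bump h) (bump_nonneg p q) hd S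

lemma le_two_pi_of_le_interaction (hab : ∀ i, a i < b i)
    (hd : ∀ i j, i ≠ j → Disjoint (Ioo (a i) (b i)) (Ioo (a j) (b j))) {S : Finset ι}
    {p q I : ℝ} (h : p < q) (hle : ∀ i ∈ S, b i - a i ≤ q - p)
    (hpq : ∀ i ∈ S, Disjoint (Ioo p q) (Ioo (a i) (b i)))
    (hI : I ≤ π * (q - p) + π / 50 * ∑ i ∈ S, (bump p q ((a i + b i) / 2) * (b i - a i) +
      bump (a i) (b i) ((p + q) / 2) * (q - p))) :
    I ≤ 2 * π * (q - p) := by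
  have h1 := sum_interaction_le hab hd h hle hpq
  have h2 := mul_le_mul_of_nonneg_left h1 (by positivity : 0 ≤ π / 50)
  have h3 : 0 < π * (q - p) := mul_pos pi_pos (sub_pos.2 h)
  have h4 : π * (π * (q - p)) ≤ 4 * (π * (q - p)) := by gcongr; exact pi_le_four
  linarith

/-- The product over intervals no longer than `(p, q)` and disjoint from it has bounded average
against the bump of `(p, q)`. -/
lemma integral_bump_mul_bumpProd_le_interaction (hab : ∀ i, a i < b i)
    (hd : ∀ i j, i ≠ j → Disjoint (Ioo (a i) (b i)) (Ioo (a j) (b j))) (S : Finset ι) :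
    ∀ p q : ℝ, p < q → (∀ i ∈ S, b i - a i ≤ q - p) →
      (∀ i ∈ S, Disjoint (Ioo p q) (Ioo (a i) (b i))) →
      ∫ x, bump p q x * bumpProd a b S x ≤
        π * (q - p) + π / 50 * ∑ i ∈ S, (bump p q ((a i + b i) / 2) * (b i - a i) +
          bump (a i) (b i) ((p + q) / 2) * (q - p)) := by
  classical
  induction S using Finset.induction_on_max_value (fun i => b i - a i) with
  | empty =>
    intro p q h _ _
    simp [bumpProd, integral_bump h]
  | insert m S hm hmax ih =>
    intro p q h hle hpq
    have hleS : ∀ i ∈ S, b i - a i ≤ q - p := fun i hi => hle i (Finset.mem_insert_of_mem hi)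
    have hpqS := fun i hi => hpq i (Finset.mem_insert_of_mem hi)
    have i1 := ih p q h hleS hpqS
    have b1 := le_two_pi_of_le_interaction hab hd h hleS hpqS i1
    have dm : ∀ i ∈ S, Disjoint (Ioo (a m) (b m)) (Ioo (a i) (b i)) := fun i hi =>
      hd m i fun e => hm (e ▸ hi)
    have b2 := le_two_pi_of_le_interaction hab hd (hab m) hmax dm
      (ih (a m) (b m) (hab m) hmax dm)
    have int1 := integrable_mul_bumpProd hab S (integrable_bump h)
    have int2 := integrable_mul_bumpProd hab S (integrable_bump (hab m))
    have int3 := int2.const_mul (1 / 100 * bump p q ((a m + b m) / 2))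
    have int4 := int1.const_mul (1 / 100 * bump (a m) (b m) ((p + q) / 2))
    have hstep : ∫ x, bump p q x * bumpProd a b (insert m S) x ≤
        ∫ x, (bump p q x * bumpProd a b S x +
          (1 / 100 * bump p q ((a m + b m) / 2) * (bump (a m) (b m) x * bumpProd a b S x) +
          1 / 100 * bump (a m) (b m) ((p + q) / 2) * (bump p q x * bumpProd a b S x))) := by
      refine integral_mono (integrable_mul_bumpProd hab _ (integrable_bump h))
        (int1.add (int3.add int4)) fun x => ?_
      simp only [bumpProd_insert hm]
      have := mul_le_mul_of_nonneg_right (bump_mul_bump_le h (hab m) x)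
        (bumpProd_nonneg (a := a) (b := b) S x)
      linarith
    rw [integral_add int1 (by exact int3.add int4), integral_add int3 int4, integral_const_mul,
      integral_const_mul] at hstep
    rw [Finset.sum_insert hm]
    have e1 := mul_le_mul_of_nonneg_left b2 (bump_nonneg p q ((a m + b m) / 2))
    have e2 := mul_le_mul_of_nonneg_left b1 (bump_nonneg (a m) (b m) ((p + q) / 2))
    linarith

lemma setIntegral_bumpProd_le {A B : ℝ} (hAB : A < B) (hab : ∀ i, a i < b i)
    (hd : ∀ i j, i ≠ j → Disjoint (Ioo (a i) (b i)) (Ioo (a j) (b j))) (S : Finset ι) :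
    ∫ x in Ioo A B, bumpProd a b S x ≤ (B - A) + 1 / 50 * ∑ i ∈ S, (b i - a i) := by
  classical
  induction S using Finset.induction_on_max_value (fun i => b i - a i) with
  | empty => simp [bumpProd, hAB.le]
  | insert m S hm hmax ih =>
    have dm : ∀ i ∈ S, Disjoint (Ioo (a m) (b m)) (Ioo (a i) (b i)) := fun i hi =>
      hd m i fun e => hm (e ▸ hi)
    have b2 := le_two_pi_of_le_interaction hab hd (hab m) hmax dm
      (integral_bump_mul_bumpProd_le_interaction hab hd S (a m) (b m) (hab m) hmax dm)
    have int2 := integrable_mul_bumpProd hab S (integrable_bump (hab m))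
    have int3 : IntegrableOn (bumpProd a b S) (Ioo A B) :=
      ((continuous_bumpProd hab S).integrableOn_Icc).mono_set Ioo_subset_Icc_self
    have h1 := setIntegral_le_integral (s := Ioo A B) int2 (Eventually.of_forall fun x =>
      mul_nonneg (bump_nonneg (a m) (b m) x) (bumpProd_nonneg S x))
    simp only [bumpProd_insert hm]
    rw [integral_add int3 (int2.integrableOn.const_mul _), integral_const_mul,
      Finset.sum_insert hm]
    have h2 : π * (b m - a m) ≤ 4 * (b m - a m) :=
      mul_le_mul_of_nonneg_right pi_le_four (sub_pos.2 (hab m)).le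
    linarith

lemma volume_sum_bump_gt_le {A B : ℝ} (hAB : A < B) (hab : ∀ i, a i < b i)
    (hsub : ∀ i, Ioo (a i) (b i) ⊆ Ioo A B)
    (hd : ∀ i j, i ≠ j → Disjoint (Ioo (a i) (b i)) (Ioo (a j) (b j))) (S : Finset ι) (ρ : ℝ) :
    volume {x ∈ Ioo A B | ρ < ∑ i ∈ S, bump (a i) (b i) x} ≤
      ENNReal.ofReal (2 * rexp (-(1 / 800) * ρ) * (B - A)) := by
  have int3 : IntegrableOn (bumpProd a b S) (Ioo A B) :=
    ((continuous_bumpProd hab S).integrableOn_Icc).mono_set Ioo_subset_Icc_self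
  have h1 := mul_meas_ge_le_integral_of_nonneg (μ := volume.restrict (Ioo A B))
    (Eventually.of_forall (bumpProd_nonneg S)) int3 (rexp (1 / 800 * ρ))
  have h2 : ∫ x in Ioo A B, bumpProd a b S x ≤ 2 * (B - A) := by
    have := setIntegral_bumpProd_le hAB hab hd S
    have := sum_length_le hAB hab hsub hd S
    linarith
  have hsubset : {x ∈ Ioo A B | ρ < ∑ i ∈ S, bump (a i) (b i) x} ⊆
      {x | rexp (1 / 800 * ρ) ≤ bumpProd a b S x} ∩ Ioo A B := fun x hx =>
    ⟨(Real.exp_le_exp.2 (by linarith [hx.2])).trans (exp_sum_le_bumpProd S x), hx.1⟩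
  have hfin : volume ({x | rexp (1 / 800 * ρ) ≤ bumpProd a b S x} ∩ Ioo A B) ≠ ⊤ :=
    measure_ne_top_of_subset inter_subset_right (by simp)
  refine (measure_mono hsubset).trans ?_
  rw [measureReal_restrict_apply' measurableSet_Ioo] at h1
  rw [← ENNReal.ofReal_toReal hfin]
  refine ENNReal.ofReal_le_ofReal ?_
  have h3 := h1.trans h2
  rw [neg_mul, Real.exp_neg, mul_right_comm, ← div_eq_mul_inv, le_div_iff₀ (Real.exp_pos _),
    mul_comm]
  exact h3

end Family

/-- cf. Lemma 5 of Carleson: there are absolute constants `c, c₀ > 0` such that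
for every finite interval `w* = (A,B)` and every countable partition (up to a null set) of `w*`
into pairwise disjoint subintervals `(a i, b i)`, the function
`Δ_Ω(x) = Σ_i |w'_i|²/((x - c(w'_i))² + |w'_i|²)` satisfies
`|{x ∈ w* : Δ_Ω(x) > ρ}| ≤ c · exp(-c₀ρ) · |w*|` for every `ρ > 0`. -/
theorem statement15 :
    ∃ c c₀ : ℝ, 0 < c ∧ 0 < c₀ ∧
      ∀ (ι : Type) [Countable ι] (A B : ℝ), A < B →
        ∀ a b : ι → ℝ, (∀ i, a i < b i) →
          (∀ i, Ioo (a i) (b i) ⊆ Ioo A B) →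
          (∀ i j, i ≠ j → Disjoint (Ioo (a i) (b i)) (Ioo (a j) (b j))) →
          volume (Ioo A B \ ⋃ i, Ioo (a i) (b i)) = 0 →
          ∀ ρ : ℝ, 0 < ρ →
            volume {x ∈ Ioo A B |
                ENNReal.ofReal ρ < ∑' i, ENNReal.ofReal
                  ((b i - a i) ^ 2 / ((x - (a i + b i) / 2) ^ 2 + (b i - a i) ^ 2))} ≤
              ENNReal.ofReal (c * Real.exp (-c₀ * ρ) * (B - A)) := by
  refine ⟨2, 1 / 800, by norm_num, by norm_num, ?_⟩
  intro ι _ A B hAB a b hab hsub hd _ ρ _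
  have hunion : {x ∈ Ioo A B | ENNReal.ofReal ρ < ∑' i, ENNReal.ofReal
      ((b i - a i) ^ 2 / ((x - (a i + b i) / 2) ^ 2 + (b i - a i) ^ 2))} ⊆
      ⋃ S : Finset ι, {x ∈ Ioo A B | ρ < ∑ i ∈ S, bump (a i) (b i) x} := by
    rintro x ⟨hx, hρ⟩
    rw [ENNReal.tsum_eq_iSup_sum] at hρ
    obtain ⟨S, hS⟩ := lt_iSup_iff.1 hρ
    change _ < ∑ i ∈ S, ENNReal.ofReal (bump (a i) (b i) x) at hS
    rw [← ENNReal.ofReal_sum_of_nonneg fun i _ => bump_nonneg (a i) (b i) x] at hS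
    exact mem_iUnion.2 ⟨S, hx, (ENNReal.ofReal_lt_ofReal_iff'.1 hS).1⟩
  have hdir : Directed (· ⊆ ·)
      fun S : Finset ι => {x ∈ Ioo A B | ρ < ∑ i ∈ S, bump (a i) (b i) x} :=
    Monotone.directed_le fun S T hST x hx => ⟨hx.1, hx.2.trans_le
      (Finset.sum_le_sum_of_subset_of_nonneg hST fun i _ _ => bump_nonneg (a i) (b i) x)⟩
  refine (measure_mono hunion).trans ?_
  rw [hdir.measure_iUnion]
  exact iSup_le fun S => volume_sum_bump_gt_le hAB hab hsub hd S ρ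

end
end
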